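/- Let K and K̄ be two arcs in PG(2,q) with K̄ a proper subset of K, and suppose both K and K̄ are hyperfocused on the same line l. Then |K| ≥ 2·|K̄|. -/

import Mathlib

open scoped LinearAlgebra.Projectivization

/-- The projective plane over a field `F`. -/
abbrev PG2 (F : Type*) [Field F] := Projectivization F (Fin 3 → F)

variable {F : Type*} [Field F]

/-- A line of `PG2 F`: the zero set of a nonzero linear form. -/
def IsLine (l : Set (PG2 F)) : Prop :=
  ∃ f : (Fin 3 → F) →ₗ[F] F, f ≠ 0 ∧ l = {P : PG2 F | f P.rep = 0}

/-- Three points of `PG2 F` are collinear if some line contains them all. -/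
def Collinear3 (A B C : PG2 F) : Prop :=
  ∃ l : Set (PG2 F), IsLine l ∧ A ∈ l ∧ B ∈ l ∧ C ∈ l

/-- An arc: a set of points no three of which are collinear, i.e. every line
meets it in at most two points. -/
def IsArc (K : Set (PG2 F)) : Prop :=
  ∀ l : Set (PG2 F), IsLine l → (K ∩ l).ncard ≤ 2

/-- A secant (chord) of `K`: a line containing at least two points of `K`. -/
def IsSecant (K l : Set (PG2 F)) : Prop :=
  IsLine l ∧ 2 ≤ (K ∩ l).ncard

/-- A blocking set of the secants of `K`: a set of points disjoint from `K`
meeting every secant of `K`. -/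
def IsBlockingSet (K B : Set (PG2 F)) : Prop :=
  B ∩ K = ∅ ∧ ∀ l : Set (PG2 F), IsSecant K l → (B ∩ l).Nonempty

/-- The focus set of `K` on `l`: the points of `l` lying on some secant of `K`. -/
def FocusSet (K l : Set (PG2 F)) : Set (PG2 F) :=
  {P : PG2 F | P ∈ l ∧ ∃ m : Set (PG2 F), IsSecant K m ∧ P ∈ m}

/-- `K` is hyperfocused on the exterior line `l` if the secants of `K` meet `l`
in exactly `|K| - 1` points. -/
def Hyperfocused (K l : Set (PG2 F)) : Prop :=
  IsLine l ∧ K ∩ l = ∅ ∧ (FocusSet K l).ncard = K.ncard - 1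

/-- `K` is sharply focused on the exterior line `l` if the secants of `K` meet `l`
in exactly `|K|` points. -/
def SharplyFocused (K l : Set (PG2 F)) : Prop :=
  IsLine l ∧ K ∩ l = ∅ ∧ (FocusSet K l).ncard = K.ncard

/-- A conic: the zero set of an irreducible homogeneous quadratic form. -/
def IsConic (C : Set (PG2 F)) : Prop :=
  ∃ Q : MvPolynomial (Fin 3) F, Q.IsHomogeneous 2 ∧ Irreducible Q ∧
    C = {P : PG2 F | MvPolynomial.eval P.rep Q = 0}

/-- A tangent line to a point set `C`: a line meeting `C` in exactly one point. -/
def IsTangentLine (C l : Set (PG2 F)) : Prop :=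
  IsLine l ∧ (C ∩ l).ncard = 1

/-- A projectivity of `PG2 F`: a map induced by a linear automorphism. -/
def IsProjectivity (φ : PG2 F → PG2 F) : Prop :=
  ∃ g : (Fin 3 → F) ≃ₗ[F] (Fin 3 → F),
    ∀ P : PG2 F, φ P = Projectivization.map g.toLinearMap g.injective P

lemma mk3_ne_zero {a b c : F} (h : a ≠ 0 ∨ b ≠ 0 ∨ c ≠ 0) :
    (![a, b, c] : Fin 3 → F) ≠ 0 := by
  intro hv
  rcases h with h | h | h
  · exact h (by simpa using congrFun hv 0)
  · exact h (by simpa using congrFun hv 1)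
  · exact h (by simpa using congrFun hv 2)

/-- The point of `PG2 F` with homogeneous coordinates `(a, b, c)`. -/
def pt (a b c : F) (h : (![a, b, c] : Fin 3 → F) ≠ 0) : PG2 F :=
  Projectivization.mk F ![a, b, c] h

/-- The linear automorphism `(X₁, X₂, X₃) ↦ (X₁ + a₁·X₃, X₂ + a₂·X₃, X₃)`. -/
def tEquiv (A : F × F) : (Fin 3 → F) ≃ₗ[F] (Fin 3 → F) where
  toFun v := ![v 0 + A.1 * v 2, v 1 + A.2 * v 2, v 2]
  invFun v := ![v 0 - A.1 * v 2, v 1 - A.2 * v 2, v 2]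
  left_inv v := by funext i; fin_cases i <;> simp
  right_inv v := by funext i; fin_cases i <;> simp
  map_add' u v := by funext i; fin_cases i <;> simp <;> ring
  map_smul' c v := by funext i; fin_cases i <;> simp <;> ring

/-- The projectivity `φ_A` of `PG2 F` induced by `tEquiv A`. -/
def tφ (A : F × F) : PG2 F → PG2 F :=
  Projectivization.map (tEquiv A).toLinearMap (tEquiv A).injective

/-- The orbit `K_G(P)` of a point `P` under the translation group `T_G`. -/
def tOrbit (G : AddSubgroup (F × F)) (P : PG2 F) : Set (PG2 F) :=
  {Q : PG2 F | ∃ A ∈ G, Q = tφ A P}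

/-- A translation arc: an arc which is an orbit `K_G(P)`. -/
def IsTranslationArc (K : Set (PG2 F)) : Prop :=
  IsArc K ∧ ∃ (G : AddSubgroup (F × F)) (P : PG2 F), K = tOrbit G P

open Projectivization in
lemma isLine_iff_exists_orthogonal {l : Set (PG2 F)} :
    IsLine l ↔ ∃ w : PG2 F, l = {P : PG2 F | orthogonal P w} := by
  have key (w : Fin 3 → F) (hw : w ≠ 0) (P : PG2 F) :
      orthogonal P (mk F w hw) ↔ dotProductEquiv F (Fin 3) w P.rep = 0 := by
    conv_lhs => rw [← P.mk_rep]
    rw [orthogonal_mk, dotProduct_comm]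
    rfl
  constructor
  · rintro ⟨f, hf, rfl⟩
    obtain ⟨w, rfl⟩ := (dotProductEquiv F (Fin 3)).surjective f
    have hw : w ≠ 0 := fun h ↦ hf (by rw [h, map_zero])
    exact ⟨mk F w hw, Set.ext fun P ↦ (key w hw P).symm⟩
  · rintro ⟨w, rfl⟩
    induction w using Projectivization.ind with | h w hw =>
    exact ⟨dotProductEquiv F (Fin 3) w, (map_ne_zero_iff _ (LinearEquiv.injective _)).2 hw,
      Set.ext fun P ↦ key w hw P⟩

lemma exists_isLine_mem_mem {P Q : PG2 F} (h : P ≠ Q) :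
    ∃ m : Set (PG2 F), IsLine m ∧ P ∈ m ∧ Q ∈ m := by
  classical
  exact ⟨_, isLine_iff_exists_orthogonal.2 ⟨_, rfl⟩, Projectivization.orthogonal_cross_left h,
    Projectivization.orthogonal_cross_right h⟩

lemma IsLine.exists_mem_mem {l m : Set (PG2 F)} (hl : IsLine l) (hm : IsLine m) (h : l ≠ m) :
    ∃ P, P ∈ l ∧ P ∈ m := by
  classical
  obtain ⟨v, rfl⟩ := isLine_iff_exists_orthogonal.1 hl
  obtain ⟨w, rfl⟩ := isLine_iff_exists_orthogonal.1 hm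
  have hvw : v ≠ w := fun e ↦ h (by rw [e])
  exact ⟨_, Projectivization.cross_orthogonal_left hvw,
    Projectivization.cross_orthogonal_right hvw⟩

lemma IsLine.eq_of_mem {l m : Set (PG2 F)} (hl : IsLine l) (hm : IsLine m) {P Q : PG2 F}
    (h : P ≠ Q) (hPl : P ∈ l) (hQl : Q ∈ l) (hPm : P ∈ m) (hQm : Q ∈ m) : l = m := by
  classical
  obtain ⟨v, rfl⟩ := isLine_iff_exists_orthogonal.1 hl
  obtain ⟨w, rfl⟩ := isLine_iff_exists_orthogonal.1 hm
  have hvw : P = Q ∨ v = w := Configuration.Nondegenerate.eq_or_eq hPl hQl hPm hQm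
  rw [hvw.resolve_left h]

/-- Projection from a point `Q` onto a line not through `Q`. -/
lemma IsLine.exists_projection {l : Set (PG2 F)} (hl : IsLine l) {Q : PG2 F} (hQ : Q ∉ l) :
    ∃ f : PG2 F → PG2 F, ∀ R, R ≠ Q →
      f R ∈ l ∧ ∃ m, IsLine m ∧ Q ∈ m ∧ R ∈ m ∧ f R ∈ m := by
  have h : ∀ R, R ≠ Q → ∃ S, S ∈ l ∧ ∃ m, IsLine m ∧ Q ∈ m ∧ R ∈ m ∧ S ∈ m := by
    intro R hR
    obtain ⟨m, hm, hRm, hQm⟩ := exists_isLine_mem_mem hR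
    obtain ⟨S, hSl, hSm⟩ := hl.exists_mem_mem hm (fun e ↦ hQ (e ▸ hQm))
    exact ⟨S, hSl, m, hm, hQm, hRm, hSm⟩
  have : Nonempty (PG2 F) := ⟨Q⟩
  choose! f hf using h
  exact ⟨f, hf⟩

lemma IsArc.eq_of_mem [Finite F] {K m : Set (PG2 F)} (hK : IsArc K) (hm : IsLine m)
    {A B C : PG2 F} (hA : A ∈ K) (hB : B ∈ K) (hC : C ∈ K) (hAm : A ∈ m) (hBm : B ∈ m)
    (hCm : C ∈ m) (hBA : B ≠ A) (hCA : C ≠ A) : B = C := by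
  by_contra hBC
  have h3 : ({A, B, C} : Set (PG2 F)).ncard = 3 :=
    Set.ncard_eq_three.2 ⟨A, B, C, hBA.symm, hCA.symm, hBC, rfl⟩
  have hsub : ({A, B, C} : Set (PG2 F)) ⊆ K ∩ m := by
    rintro x (rfl | rfl | rfl) <;> exact ⟨‹_›, ‹_›⟩
  have := Set.ncard_le_ncard hsub (Set.toFinite _)
  have := hK m hm
  omega

lemma isSecant_of_mem [Finite F] {K m : Set (PG2 F)} (hm : IsLine m) {A B : PG2 F}
    (hA : A ∈ K) (hB : B ∈ K) (hAm : A ∈ m) (hBm : B ∈ m) (h : A ≠ B) : IsSecant K m := by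
  refine ⟨hm, ?_⟩
  rw [← Set.ncard_pair h]
  refine Set.ncard_le_ncard ?_ (Set.toFinite _)
  rintro x (rfl | rfl) <;> exact ⟨‹_›, ‹_›⟩

lemma focusSet_mono [Finite F] {K K' l : Set (PG2 F)} (h : K' ⊆ K) :
    FocusSet K' l ⊆ FocusSet K l := by
  rintro P ⟨hPl, m, ⟨hm, hc⟩, hPm⟩
  exact ⟨hPl, m, ⟨hm, hc.trans (Set.ncard_le_ncard (Set.inter_subset_inter_left m h)
    (Set.toFinite _))⟩, hPm⟩

/-- Distinct points of an arc project from another of its points to distinct foci. -/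
lemma IsArc.injOn_projection [Finite F] {K l : Set (PG2 F)} (hK : IsArc K) {Q : PG2 F}
    (hQK : Q ∈ K) (hQl : Q ∉ l) {f : PG2 F → PG2 F}
    (hf : ∀ R, R ≠ Q → f R ∈ l ∧ ∃ m, IsLine m ∧ Q ∈ m ∧ R ∈ m ∧ f R ∈ m) :
    Set.InjOn f (K \ {Q}) := by
  rintro R ⟨hR, hRQ⟩ S ⟨hS, hSQ⟩ hRS
  obtain ⟨hRl, m, hm, hQm, hRm, hfm⟩ := hf R hRQ
  obtain ⟨-, n, hn, hQn, hSn, hfn⟩ := hf S hSQ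
  have hmn : m = n := hm.eq_of_mem hn (fun e : Q = f R ↦ hQl (e ▸ hRl)) hQm hfm hQn
    (hRS ▸ hfn)
  exact hK.eq_of_mem hm hQK hR hS hQm hRm (hmn ▸ hSn) hRQ hSQ

/-- Every focus of a hyperfocused arc lies on a secant through any given point of the arc. -/
lemma Hyperfocused.exists_secant [Finite F] {K l : Set (PG2 F)} (hK : IsArc K)
    (h : Hyperfocused K l) {Q B : PG2 F} (hQ : Q ∈ K) (hB : B ∈ FocusSet K l) :
    ∃ R ∈ K, R ≠ Q ∧ ∃ m, IsLine m ∧ Q ∈ m ∧ R ∈ m ∧ B ∈ m := by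
  obtain ⟨hl, hKl, hcard⟩ := h
  have hQl : Q ∉ l := Set.disjoint_left.1 (Set.disjoint_iff_inter_eq_empty.2 hKl) hQ
  obtain ⟨f, hf⟩ := hl.exists_projection hQl
  have himage : f '' (K \ {Q}) = FocusSet K l := by
    refine Set.eq_of_subset_of_ncard_le ?_ ?_ (Set.toFinite _)
    · rintro _ ⟨R, ⟨hR, hRQ⟩, rfl⟩
      obtain ⟨hRl, m, hm, hQm, hRm, hfm⟩ := hf R hRQ
      exact ⟨hRl, m, isSecant_of_mem hm hR hQ hRm hQm hRQ, hfm⟩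
    · rw [(hK.injOn_projection hQ hQl hf).ncard_image, hcard,
        Set.ncard_sdiff_singleton_of_mem hQ]
  obtain ⟨R, ⟨hR, hRQ⟩, rfl⟩ := himage ▸ hB
  exact ⟨R, hR, hRQ, (hf R hRQ).2⟩

/-- if `K̄ ⊊ K` are both hyperfocused on the same line `l`, then
`|K| ≥ 2|K̄|`. -/
theorem card_ge_two_mul_of_nested_hyperfocused {F : Type*} [Field F] [Fintype F]
    (K Kbar l : Set (PG2 F)) (harcK : IsArc K) (harcKbar : IsArc Kbar)
    (hss : Kbar ⊂ K) (hK : Hyperfocused K l) (hKbar : Hyperfocused Kbar l) :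
    2 * Kbar.ncard ≤ K.ncard := by
  obtain ⟨hsub, P, hPK, hPKbar⟩ := Set.ssubset_iff_exists.1 hss
  obtain ⟨hl, hKl, hcard⟩ := hK
  have hdisj := Set.disjoint_left.1 (Set.disjoint_iff_inter_eq_empty.2 hKl)
  have hPl : P ∉ l := hdisj hPK
  obtain ⟨f, hf⟩ := hl.exists_projection hPl
  have hne : ∀ Q ∈ Kbar, Q ≠ P := fun Q hQ e ↦ hPKbar (e ▸ hQ)
  have hinj : Set.InjOn f Kbar :=
    (harcK.injOn_projection hPK hPl hf).mono
      (Set.subset_sdiff_singleton hsub hPKbar)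
  have himage : f '' Kbar ⊆ FocusSet K l \ FocusSet Kbar l := by
    rintro _ ⟨Q, hQ, rfl⟩
    obtain ⟨hfl, m, hm, hPm, hQm, hfm⟩ := hf Q (hne Q hQ)
    refine ⟨⟨hfl, m, isSecant_of_mem hm hPK (hsub hQ) hPm hQm (hne Q hQ).symm, hfm⟩, fun hB ↦ ?_⟩
    obtain ⟨R, hR, hRQ, n, hn, hQn, hRn, hfn⟩ := hKbar.exists_secant harcKbar hQ hB
    have hQf : Q ≠ f Q := fun e ↦ hdisj (hsub hQ) (by rwa [← e] at hfl)
    have hmn : m = n := hm.eq_of_mem hn hQf hQm hfm hQn hfn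
    have hRP : R = P := harcK.eq_of_mem hm (hsub hQ) (hsub hR) hPK hQm (hmn ▸ hRn) hPm hRQ
      (hne Q hQ).symm
    exact hne R hR hRP
  have hle := Set.ncard_le_ncard himage (Set.toFinite _)
  rw [hinj.ncard_image, Set.ncard_sdiff (focusSet_mono hsub), hcard, hKbar.2.2] at hle
  omega
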